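/- arXiv:2412.20702 — 4 statements merged into one kernel-verified Lean document; each statement's English description precedes it below -/
import Mathlib

section
/- Let n and m be positive integers and let G be a connected simple graph on n vertices and m edges that is Tutte-maximum in C_{n,m}. Then G is uniformly most reliable in C_{n,m}, i.e., R_G^{(1)}(p) ≥ R_H^{(1)}(p) for every connected simple graph H on n vertices and m edges and every p ∈ [0,1]. -/
open MvPolynomial

/-- Number of connected components of the spanning subgraph of a graph on `Fin n`
whose edge set is `s`. -/
noncomputable def ncomp (n : ℕ) (s : Set (Sym2 (Fin n))) : ℕ :=
  Nat.card (SimpleGraph.fromEdgeSet s).ConnectedComponent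

/-- `G` is a member of `C_{n,m}`: a connected simple graph on `n` vertices and `m` edges. -/
def IsCnm (n m : ℕ) (G : SimpleGraph (Fin n)) : Prop :=
  G.Connected ∧ G.edgeSet.ncard = m

/-- `N_i^{(k)}(G)`: the number of spanning subgraphs of `G` (identified with subsets of
`E(G)`) having exactly `i` edges and at most `k` connected components. -/
noncomputable def Ncnt (n : ℕ) (G : SimpleGraph (Fin n)) (i k : ℕ) : ℕ :=
  Set.ncard {s : Set (Sym2 (Fin n)) | s ⊆ G.edgeSet ∧ s.ncard = i ∧ ncomp n s ≤ k}

/-- `N_{i,j}(G)`: the number of spanning subgraphs of `G` having exactly `i` edges and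
exactly `j` connected components. -/
noncomputable def Nexact (n : ℕ) (G : SimpleGraph (Fin n)) (i j : ℕ) : ℕ :=
  Set.ncard {s : Set (Sym2 (Fin n)) | s ⊆ G.edgeSet ∧ s.ncard = i ∧ ncomp n s = j}

/-- The `k`-reliability of `G` at `p`: `R_G^{(k)}(p) = Σ_{i=0}^m N_i^{(k)}(G) p^i (1-p)^{m-i}`. -/
noncomputable def rel (n m : ℕ) (G : SimpleGraph (Fin n)) (k : ℕ) (p : ℝ) : ℝ :=
  ∑ i ∈ Finset.range (m + 1), (Ncnt n G i k : ℝ) * p ^ i * (1 - p) ^ (m - i)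

/-- The Tutte polynomial of `G`, `T_G(x,y) = Σ_{H ∈ S(G)} (x-1)^{r(G)-r(H)} (y-1)^{c(H)}`,
where the rank of the spanning subgraph with edge set `s` is `n - ncomp n s`, so that
`r(G) - r(H) = ncomp n s - ncomp n G.edgeSet`, and the corank is `s.ncard + ncomp n s - n`. -/
noncomputable def tutte (n : ℕ) (G : SimpleGraph (Fin n)) : MvPolynomial (Fin 2) ℝ :=
  ∑ᶠ s ∈ {t : Set (Sym2 (Fin n)) | t ⊆ G.edgeSet},
    (X 0 - 1) ^ (ncomp n s - ncomp n G.edgeSet) * (X 1 - 1) ^ (s.ncard + ncomp n s - n)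

/-- The Whitney polynomial of `G`, `W_G(x,y) = Σ_{H ∈ S(G)} x^{r(G)-r(H)} y^{c(H)}`. -/
noncomputable def whitney (n : ℕ) (G : SimpleGraph (Fin n)) : MvPolynomial (Fin 2) ℝ :=
  ∑ᶠ s ∈ {t : Set (Sym2 (Fin n)) | t ⊆ G.edgeSet},
    X 0 ^ (ncomp n s - ncomp n G.edgeSet) * X 1 ^ (s.ncard + ncomp n s - n)

/-- A bivariate polynomial is nonnegative if all its coefficients are nonnegative. -/
def NonnegPoly (P : MvPolynomial (Fin 2) ℝ) : Prop :=
  ∀ d : Fin 2 →₀ ℕ, 0 ≤ P.coeff d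

/-- `G` is Tutte-maximum in `C_{n,m}`. -/
def TutteMaximum (n m : ℕ) (G : SimpleGraph (Fin n)) : Prop :=
  ∀ H : SimpleGraph (Fin n), IsCnm n m H →
    ∃ P : MvPolynomial (Fin 2) ℝ, NonnegPoly P ∧
      tutte n G - tutte n H = (X 0 + X 1 - X 0 * X 1) * P

/-- `G` is Whitney-maximum in `C_{n,m}`. -/
def WhitneyMaximum (n m : ℕ) (G : SimpleGraph (Fin n)) : Prop :=
  ∀ H : SimpleGraph (Fin n), IsCnm n m H →
    ∃ Q : MvPolynomial (Fin 2) ℝ, NonnegPoly Q ∧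
      whitney n G - whitney n H = (1 - X 0 * X 1) * Q

/-- `G` is strong in `C_{n,m}`. -/
def Strong (n m : ℕ) (G : SimpleGraph (Fin n)) : Prop :=
  ∀ H : SimpleGraph (Fin n), IsCnm n m H →
    ∀ i ≤ m, ∀ k, 1 ≤ k → k ≤ n → Ncnt n H i k ≤ Ncnt n G i k

/-- `G` is a 0-element in `C_{n,m}`. -/
def ZeroElement (n m : ℕ) (G : SimpleGraph (Fin n)) : Prop :=
  ∀ H : SimpleGraph (Fin n), IsCnm n m H → ∀ i ≤ m, Ncnt n H i 1 ≤ Ncnt n G i 1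

/-- `t_k(G)`: the number of spanning forests of `G` composed of exactly `k` trees. -/
noncomputable def tcount (n : ℕ) (G : SimpleGraph (Fin n)) (k : ℕ) : ℕ :=
  Set.ncard {s : Set (Sym2 (Fin n)) |
    s ⊆ G.edgeSet ∧ (SimpleGraph.fromEdgeSet s).IsAcyclic ∧ ncomp n s = k}

/-- `λ^{(k)}(G)`: the minimum number of edges that must be removed from `G` to obtain a
spanning subgraph with more than `k` connected components. -/
noncomputable def lamk (n : ℕ) (G : SimpleGraph (Fin n)) (k : ℕ) : ℕ :=
  sInf {d : ℕ | ∃ D : Set (Sym2 (Fin n)),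
    D ⊆ G.edgeSet ∧ D.ncard = d ∧ k < ncomp n (G.edgeSet \ D)}

/-- `∂^{a+b} P / ∂x^a ∂y^b` evaluated at `(0,0)`. -/
noncomputable def pdevalXY (P : MvPolynomial (Fin 2) ℝ) (a b : ℕ) : ℝ :=
  MvPolynomial.eval (fun _ => (0 : ℝ))
    ((fun q => MvPolynomial.pderiv (0 : Fin 2) q)^[a]
      ((fun q => MvPolynomial.pderiv (1 : Fin 2) q)^[b] P))

open Classical in
/-- The edge sets of the connected spanning subgraphs of `G`. -/
noncomputable def connSpanning (n : ℕ) (G : SimpleGraph (Fin n)) : Finset (Set (Sym2 (Fin n))) :=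
  Finset.univ.filter fun s => s ⊆ G.edgeSet ∧ ncomp n s ≤ 1

theorem mem_connSpanning {n : ℕ} {G : SimpleGraph (Fin n)} {s : Set (Sym2 (Fin n))} :
    s ∈ connSpanning n G ↔ s ⊆ G.edgeSet ∧ ncomp n s ≤ 1 := by
  simp [connSpanning]

theorem one_le_ncomp {n : ℕ} (hn : 0 < n) (s : Set (Sym2 (Fin n))) : 1 ≤ ncomp n s := by
  have : Nonempty (SimpleGraph.fromEdgeSet s).ConnectedComponent :=
    ⟨(SimpleGraph.fromEdgeSet s).connectedComponentMk ⟨0, hn⟩⟩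
  exact Nat.card_pos

theorem connected_of_ncomp_le_one {n : ℕ} (hn : 0 < n) {s : Set (Sym2 (Fin n))}
    (hs : ncomp n s ≤ 1) : (SimpleGraph.fromEdgeSet s).Connected := by
  have hsub : Subsingleton (SimpleGraph.fromEdgeSet s).ConnectedComponent :=
    Finite.card_le_one_iff_subsingleton.mp hs
  have : Nonempty (Fin n) := ⟨⟨0, hn⟩⟩
  exact ⟨fun u v => SimpleGraph.ConnectedComponent.exact (Subsingleton.elim _ _)⟩

theorem ncomp_edgeSet_of_connected {n : ℕ} {G : SimpleGraph (Fin n)} (hG : G.Connected) :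
    ncomp n G.edgeSet = 1 := by
  have := hG.preconnected.subsingleton_connectedComponent
  have hne := hG.nonempty.map G.connectedComponentMk
  rw [ncomp, SimpleGraph.fromEdgeSet_edgeSet]
  exact Nat.card_eq_one_iff_unique.mpr ⟨this, hne⟩

theorem card_le_ncard_add_one {n : ℕ} (hn : 0 < n) {G : SimpleGraph (Fin n)}
    {s : Set (Sym2 (Fin n))} (hs : s ∈ connSpanning n G) : n ≤ s.ncard + 1 := by
  obtain ⟨hsub, hc⟩ := mem_connSpanning.mp hs
  have h := (connected_of_ncomp_le_one hn hc).card_vert_le_card_edgeSet_add_one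
  have hle : (SimpleGraph.fromEdgeSet s).edgeSet.ncard ≤ s.ncard :=
    Set.ncard_le_ncard (by simp) s.toFinite
  rw [Nat.card_fin, Nat.card_coe_set_eq] at h
  omega

theorem rel_eq_sum_connSpanning {n m : ℕ} {G : SimpleGraph (Fin n)} (hG : IsCnm n m G) (p : ℝ) :
    rel n m G 1 p = ∑ s ∈ connSpanning n G, p ^ s.ncard * (1 - p) ^ (m - s.ncard) := by
  classical
  have hmaps : ∀ s ∈ connSpanning n G, s.ncard ∈ Finset.range (m + 1) := fun s hs => by
    have := Set.ncard_le_ncard (mem_connSpanning.mp hs).1 G.edgeSet.toFinite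
    rw [hG.2] at this
    simpa [Nat.lt_succ_iff] using this
  rw [← Finset.sum_fiberwise_of_maps_to hmaps, rel]
  refine Finset.sum_congr rfl fun i _ => ?_
  have hN : Ncnt n G i 1 = ((connSpanning n G).filter fun s => s.ncard = i).card := by
    rw [Ncnt, ← Set.ncard_coe_finset]
    congr 1
    ext s
    simp only [Finset.coe_filter, mem_connSpanning, Set.mem_ofPred_eq]
    tauto
  rw [hN, mul_assoc, ← nsmul_eq_mul, ← Finset.sum_const]
  refine Finset.sum_congr rfl fun s hs => ?_
  rw [(Finset.mem_filter.mp hs).2]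

theorem eval_tutte_one {n : ℕ} (hn : 0 < n) {G : SimpleGraph (Fin n)} (hG : G.Connected)
    (y : ℝ) : eval ![1, y] (tutte n G) =
      ∑ s ∈ connSpanning n G, (y - 1) ^ (s.ncard + 1 - n) := by
  classical
  rw [tutte, finsum_mem_eq_finite_toFinset_sum _ (Set.toFinite _), map_sum,
    ncomp_edgeSet_of_connected hG]
  symm
  refine Finset.sum_subset_zero_on_sdiff (fun s hs => ?_) (fun s hs => ?_) (fun s hs => ?_)
  · simpa using (mem_connSpanning.mp hs).1
  · have hlt : ncomp n s - 1 ≠ 0 := by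
      simp only [Finset.mem_sdiff, Set.Finite.mem_toFinset, Set.mem_ofPred_eq,
        mem_connSpanning] at hs
      have : ¬ ncomp n s ≤ 1 := fun h => hs.2 ⟨hs.1, h⟩
      omega
    simp [zero_pow hlt]
  · have h1 : ncomp n s = 1 := le_antisymm (mem_connSpanning.mp hs).2 (one_le_ncomp hn s)
    simp [h1]

theorem rel_eq_mul_eval_tutte {n m : ℕ} (hn : 0 < n) {G : SimpleGraph (Fin n)}
    (hG : IsCnm n m G) {p : ℝ} (hp : p < 1) :
    rel n m G 1 p = (1 - p) ^ m * (p / (1 - p)) ^ (n - 1) *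
      eval ![1, 1 / (1 - p)] (tutte n G) := by
  have hq : 1 - p ≠ 0 := by linarith
  rw [rel_eq_sum_connSpanning hG, eval_tutte_one hn hG.1, Finset.mul_sum]
  refine Finset.sum_congr rfl fun s hs => ?_
  have hle : s.ncard ≤ m :=
    hG.2 ▸ Set.ncard_le_ncard (mem_connSpanning.mp hs).1 G.edgeSet.toFinite
  have hcard := card_le_ncard_add_one hn hs
  have hy : 1 / (1 - p) - 1 = p / (1 - p) := by field_simp; ring
  rw [hy, mul_assoc, ← pow_add, show n - 1 + (s.ncard + 1 - n) = s.ncard by omega, div_pow,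
    ← Nat.sub_add_cancel hle, pow_add, Nat.sub_add_cancel hle]
  field_simp

theorem NonnegPoly.eval_nonneg {P : MvPolynomial (Fin 2) ℝ} (hP : NonnegPoly P)
    {v : Fin 2 → ℝ} (hv : ∀ i, 0 ≤ v i) : 0 ≤ eval v P := by
  rw [eval_eq]
  exact Finset.sum_nonneg fun d _ =>
    mul_nonneg (hP d) (Finset.prod_nonneg fun i _ => pow_nonneg (hv i) _)

theorem continuous_rel (n m : ℕ) (G : SimpleGraph (Fin n)) (k : ℕ) :
    Continuous (rel n m G k) := by
  unfold rel
  fun_prop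

/-- each Tutte-maximum graph in `C_{n,m}` is uniformly most reliable. -/
theorem stmt1 (n m : ℕ) (hn : 0 < n) (hm : 0 < m) (G : SimpleGraph (Fin n))
    (hG : IsCnm n m G) (hT : TutteMaximum n m G) :
    ∀ H : SimpleGraph (Fin n), IsCnm n m H → ∀ p ∈ Set.Icc (0 : ℝ) 1,
      rel n m H 1 p ≤ rel n m G 1 p := by
  intro H hH p hp
  have hIoo : ∀ q ∈ Set.Ioo (0 : ℝ) 1, rel n m H 1 q ≤ rel n m G 1 q := by
    rintro q ⟨hq0, hq1⟩
    obtain ⟨P, hP, hPeq⟩ := hT H hH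
    have hq : 0 < 1 - q := by linarith
    have hP0 : 0 ≤ eval ![1, 1 / (1 - q)] P := hP.eval_nonneg fun i => by
      fin_cases i <;> simp [hq.le]
    have hle : eval ![1, 1 / (1 - q)] (tutte n H) ≤ eval ![1, 1 / (1 - q)] (tutte n G) := by
      rw [← sub_nonneg, ← map_sub, hPeq]
      simpa using hP0
    rw [rel_eq_mul_eval_tutte hn hH hq1, rel_eq_mul_eval_tutte hn hG hq1]
    exact mul_le_mul_of_nonneg_left hle (by positivity)
  rw [← closure_Ioo zero_ne_one] at hp
  exact le_on_closure hIoo (continuous_rel n m H 1).continuousOn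
    (continuous_rel n m G 1).continuousOn hp
end

section
/- Let n and m be positive integers and let G be a connected simple graph on n vertices and m edges. If G is Tutte-maximum in C_{n,m}, then G is Whitney-maximum in C_{n,m}. -/
open MvPolynomial

namespace NonnegPoly

variable {P Q : MvPolynomial (Fin 2) ℝ}

lemma C {a : ℝ} (ha : 0 ≤ a) : NonnegPoly (MvPolynomial.C a) := by
  intro d
  rw [coeff_C]
  split_ifs
  · exact ha
  · exact le_rfl

lemma one : NonnegPoly 1 := by
  simpa using C zero_le_one

lemma X (i : Fin 2) : NonnegPoly (MvPolynomial.X i) := by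
  intro d
  rw [coeff_X]
  split_ifs <;> norm_num

lemma add (hP : NonnegPoly P) (hQ : NonnegPoly Q) : NonnegPoly (P + Q) := fun d => by
  rw [coeff_add]
  exact add_nonneg (hP d) (hQ d)

lemma mul (hP : NonnegPoly P) (hQ : NonnegPoly Q) : NonnegPoly (P * Q) := fun d => by
  rw [coeff_mul]
  exact Finset.sum_nonneg fun x _ => mul_nonneg (hP x.1) (hQ x.2)

lemma pow (hP : NonnegPoly P) (k : ℕ) : NonnegPoly (P ^ k) := by
  induction k with
  | zero => simpa using one
  | succ k ih => simpa [pow_succ] using ih.mul hP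

lemma sum {ι : Type*} (s : Finset ι) (f : ι → MvPolynomial (Fin 2) ℝ)
    (hf : ∀ i ∈ s, NonnegPoly (f i)) : NonnegPoly (∑ i ∈ s, f i) := fun d => by
  rw [coeff_sum]
  exact Finset.sum_nonneg fun i hi => hf i hi d

/-- Substituting nonnegative polynomials into a nonnegative polynomial gives a nonnegative
polynomial. -/
lemma aeval (hP : NonnegPoly P) (f : Fin 2 → MvPolynomial (Fin 2) ℝ)
    (hf : ∀ i, NonnegPoly (f i)) : NonnegPoly (MvPolynomial.aeval f P) := by
  rw [aeval_def, eval₂_eq']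
  refine sum _ _ fun d _ => ?_
  rw [algebraMap_eq, Fin.prod_univ_two]
  exact (C (hP d)).mul (((hf 0).pow _).mul ((hf 1).pow _))

end NonnegPoly

/-- `W_G(x,y) = T_G(x+1,y+1)`. -/
lemma aeval_tutte_eq_whitney (n : ℕ) (G : SimpleGraph (Fin n)) :
    aeval (fun i : Fin 2 => (X i + 1 : MvPolynomial (Fin 2) ℝ)) (tutte n G) = whitney n G := by
  unfold tutte whitney
  refine (AddMonoidHom.map_finsum_mem _ (aeval _ : _ →ₐ[ℝ] MvPolynomial (Fin 2) ℝ).toRingHom.toAddMonoidHom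
    (Set.toFinite _)).trans ?_
  simp

/-- each Tutte-maximum graph in `C_{n,m}` is Whitney-maximum. -/
theorem stmt5 (n m : ℕ) (hn : 0 < n) (hm : 0 < m) (G : SimpleGraph (Fin n))
    (hG : IsCnm n m G) (hT : TutteMaximum n m G) :
    WhitneyMaximum n m G := by
  intro H hH
  obtain ⟨P, hP, h⟩ := hT H hH
  refine ⟨aeval (fun i : Fin 2 => (X i + 1 : MvPolynomial (Fin 2) ℝ)) P,
    hP.aeval _ fun i => (NonnegPoly.X i).add NonnegPoly.one, ?_⟩
  rw [← aeval_tutte_eq_whitney, ← aeval_tutte_eq_whitney, ← map_sub, h]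
  simp only [map_mul, map_sub, map_add, aeval_X]
  ring
end

section
/- Let G be a connected simple graph on n vertices and m edges. For each k ∈ {1,…,n} and each i ∈ {0,1,…,m}, N_i^{(k)}(G) = Σ_{j=max{1,n-i}}^{k} (1/((j-1)!(i-n+j)!)) · ∂^{2j+i-n-1} W_G / (∂x^{j-1} ∂y^{i-n+j}) evaluated at (0,0). -/
open MvPolynomial

theorem SimpleGraph.card_connectedComponent_le_sup_edge_add_one {V : Type*} [Finite V]
    (G : SimpleGraph V) (u v : V) :
    Nat.card G.ConnectedComponent ≤ Nat.card (G ⊔ edge u v).ConnectedComponent + 1 := by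
  classical
  have reach : ∀ x y, (G ⊔ edge u v).Reachable x y →
      G.Reachable x y ∨ (G.Reachable x u ∧ G.Reachable v y) ∨
        (G.Reachable x v ∧ G.Reachable u y) := by
    intro x y h
    rw [reachable_iff_reflTransGen] at h
    induction h with
    | refl => exact Or.inl (Reachable.refl x)
    | @tail b c _ hbc ih =>
      rw [sup_adj, edge_adj] at hbc
      rcases hbc with hbc | ⟨⟨rfl, rfl⟩ | ⟨rfl, rfl⟩, -⟩
      · have hbc := hbc.reachable
        rcases ih with h | ⟨h, h'⟩ | ⟨h, h'⟩
        · exact Or.inl (h.trans hbc)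
        · exact Or.inr (Or.inl ⟨h, h'.trans hbc⟩)
        · exact Or.inr (Or.inr ⟨h, h'.trans hbc⟩)
      · rcases ih with h | ⟨h, -⟩ | ⟨h, -⟩
        · exact Or.inr (Or.inl ⟨h, Reachable.refl _⟩)
        · exact Or.inr (Or.inl ⟨h, Reachable.refl _⟩)
        · exact Or.inl h
      · rcases ih with h | ⟨h, -⟩ | ⟨h, -⟩
        · exact Or.inr (Or.inr ⟨h, Reachable.refl _⟩)
        · exact Or.inl h
        · exact Or.inr (Or.inr ⟨h, Reachable.refl _⟩)
  rw [← Finite.card_option]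
  let f : G.ConnectedComponent → Option (G ⊔ edge u v).ConnectedComponent := fun c =>
    if c = G.connectedComponentMk u then none
    else some (c.map (Hom.ofLE le_sup_left))
  refine Nat.card_le_card_of_injective f ?_
  intro c d
  induction c using ConnectedComponent.ind with | _ x
  induction d using ConnectedComponent.ind with | _ y
  simp only [f]
  split_ifs with hx hy hy
  · intro _; rw [hx, hy]
  · simp
  · simp
  · intro h
    rw [ConnectedComponent.eq] at hx hy ⊢
    have hxy : (G ⊔ edge u v).Reachable x y := by
      simpa using h
    rcases reach x y hxy with h | ⟨h, -⟩ | ⟨-, h⟩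
    · exact h
    · exact absurd h hx
    · exact absurd h.symm hy

theorem le_ncard_add_ncomp (n : ℕ) (s : Set (Sym2 (Fin n))) : n ≤ s.ncard + ncomp n s := by
  induction s, s.toFinite using Set.Finite.induction_on with
  | empty =>
    have hinj : Function.Injective
        (SimpleGraph.fromEdgeSet (∅ : Set (Sym2 (Fin n)))).connectedComponentMk := by
      intro x y h
      rw [SimpleGraph.ConnectedComponent.eq] at h
      simpa using h
    simpa [ncomp] using Nat.card_le_card_of_injective _ hinj
  | @insert e s he _ ih =>
    rw [Set.ncard_insert_of_notMem he]
    induction e with | _ u v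
    have h := (SimpleGraph.fromEdgeSet s).card_connectedComponent_le_sup_edge_add_one u v
    rw [SimpleGraph.edge, ← SimpleGraph.fromEdgeSet_union, Set.union_singleton] at h
    simp only [ncomp] at ih ⊢
    omega

theorem ncomp_pos {n : ℕ} (hn : 1 ≤ n) (s : Set (Sym2 (Fin n))) : 1 ≤ ncomp n s := by
  have : Nonempty (Fin n) := ⟨⟨0, hn⟩⟩
  exact Nat.card_pos

theorem MvPolynomial.coeff_iterate_pderiv {σ R : Type*} [CommSemiring R] (i : σ) (k : ℕ)
    (p : MvPolynomial σ R) (d : σ →₀ ℕ) :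
    coeff d ((fun q => pderiv i q)^[k] p) =
      coeff (d + Finsupp.single i k) p * ((d i + 1).ascFactorial k : ℕ) := by
  induction k generalizing p with
  | zero => simp
  | succ k ih =>
    rw [Function.iterate_succ_apply, ih, coeff_pderiv, Nat.ascFactorial_succ, Finsupp.single_add,
      add_assoc]
    simp only [Finsupp.add_apply, Finsupp.single_eq_same]
    push_cast
    ring

theorem pdevalXY_eq_coeff (P : MvPolynomial (Fin 2) ℝ) (a b : ℕ) :
    pdevalXY P a b =
      P.coeff (Finsupp.single 0 a + Finsupp.single 1 b) * ((a.factorial : ℝ) * b.factorial) := by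
  have h (q : MvPolynomial (Fin 2) ℝ) : eval (fun _ => (0 : ℝ)) q = coeff 0 q := by
    rw [← constantCoeff_eq, ← eval_zero]
    rfl
  rw [pdevalXY, h, coeff_iterate_pderiv, coeff_iterate_pderiv]
  simp [Nat.one_ascFactorial]
  ring

theorem coeff_whitney {n : ℕ} {G : SimpleGraph (Fin n)} (hG : G.Connected) (hn : 1 ≤ n)
    {i j : ℕ} (hj : 1 ≤ j) (hij : n ≤ i + j) :
    (whitney n G).coeff (Finsupp.single 0 (j - 1) + Finsupp.single 1 (i + j - n)) =
      (Nexact n G i j : ℝ) := by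
  classical
  have hfin : {t : Set (Sym2 (Fin n)) | t ⊆ G.edgeSet}.Finite := Set.toFinite _
  rw [whitney, finsum_mem_eq_finite_toFinset_sum _ hfin, coeff_sum, Nexact,
    ncomp_edgeSet_of_connected hG]
  have hset : {s : Set (Sym2 (Fin n)) | s ⊆ G.edgeSet ∧ s.ncard = i ∧ ncomp n s = j} =
      (hfin.toFinset.filter fun s => s.ncard = i ∧ ncomp n s = j : Set (Set (Sym2 (Fin n)))) := by
    ext s
    simp
  rw [hset, Set.ncard_coe_finset, Finset.card_filter, Nat.cast_sum]
  refine Finset.sum_congr rfl fun s _ => ?_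
  rw [X_pow_eq_monomial, X_pow_eq_monomial, monomial_mul, coeff_monomial, Nat.cast_ite]
  have h1 := ncomp_pos hn s
  have h2 := le_ncard_add_ncomp n s
  have hiff : Finsupp.single (0 : Fin 2) (ncomp n s - 1) +
      Finsupp.single 1 (s.ncard + ncomp n s - n) =
        Finsupp.single 0 (j - 1) + Finsupp.single 1 (i + j - n) ↔
      s.ncard = i ∧ ncomp n s = j := by
    simp only [Finsupp.ext_iff, Fin.forall_fin_two]
    simp
    omega
  simp only [hiff, mul_one, Nat.cast_one, Nat.cast_zero]

theorem Ncnt_eq_sum_Nexact {n : ℕ} (hn : 1 ≤ n) (G : SimpleGraph (Fin n)) (i k : ℕ) :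
    Ncnt n G i k = ∑ j ∈ Finset.Icc (max 1 (n - i)) k, Nexact n G i j := by
  classical
  let A : Finset (Set (Sym2 (Fin n))) :=
    Finset.univ.filter fun s => s ⊆ G.edgeSet ∧ s.ncard = i ∧ ncomp n s ≤ k
  have hA : Ncnt n G i k = A.card := by
    rw [Ncnt, ← Set.ncard_coe_finset]
    simp [A]
  rw [hA, Finset.card_eq_sum_card_fiberwise (f := ncomp n)
    (t := Finset.Icc (max 1 (n - i)) k)]
  · refine Finset.sum_congr rfl fun j hj => ?_
    rw [Nexact, ← Set.ncard_coe_finset]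
    congr 1
    ext s
    have := (Finset.mem_Icc.1 hj).2
    simp [A]
    grind
  · intro s hs
    have h1 := ncomp_pos hn s
    have h2 := le_ncard_add_ncomp n s
    simp only [A, Finset.coe_filter, Finset.mem_univ, true_and, Set.mem_ofPred_eq] at hs
    rw [Finset.coe_Icc, Set.mem_Icc]
    omega

/-- for each `k ∈ {1,…,n}` and `i ∈ {0,…,m}`,
`N_i^{(k)}(G) = Σ_{j=max{1,n-i}}^{k} (1/((j-1)!(i-n+j)!)) ∂^{2j+i-n-1} W_G/∂x^{j-1}∂y^{i-n+j} (0,0)`. -/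
theorem stmt8 (n m : ℕ) (G : SimpleGraph (Fin n)) (hG : G.Connected)
    (hGm : G.edgeSet.ncard = m) (k : ℕ) (hk1 : 1 ≤ k) (hkn : k ≤ n) (i : ℕ) (hi : i ≤ m) :
    (Ncnt n G i k : ℝ) =
      ∑ j ∈ Finset.Icc (max 1 (n - i)) k,
        (1 / ((Nat.factorial (j - 1) : ℝ) * (Nat.factorial (i + j - n) : ℝ))) *
          pdevalXY (whitney n G) (j - 1) (i + j - n) := by
  have hn : 1 ≤ n := hk1.trans hkn
  rw [Ncnt_eq_sum_Nexact hn, Nat.cast_sum]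
  refine Finset.sum_congr rfl fun j hj => ?_
  rw [Finset.mem_Icc] at hj
  rw [pdevalXY_eq_coeff, coeff_whitney hG hn (by omega) (by omega)]
  have h1 : ((j - 1).factorial : ℝ) ≠ 0 := by positivity
  have h2 : ((i + j - n).factorial : ℝ) ≠ 0 := by positivity
  field_simp
end

section
/- Let n and m be positive integers, let G be a strong graph in C_{n,m}, and let G' be any graph in C_{n,m}. Then there exists a bijection φ from the set S(G) of spanning subgraphs of G to the set S(G') of spanning subgraphs of G' such that for every H ∈ S(G), φ(H) has the same number of edges as H and the number of connected components of φ(H) is at least the number of connected components of H. -/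
open MvPolynomial

/-- If, for every `b ∈ B`, the set `A` has at least as many elements as `B` sharing the label
`r b` and having `f`-value at most `f b`, and `A`, `B` are equinumerous, then there is a
label-preserving bijection `A ≃ B` that does not decrease `f`. -/
theorem exists_equiv_of_ncard_le {T ι κ : Type*} [Finite T] [LinearOrder κ] (A B : Set T)
    (r : T → ι) (f : T → κ) (hcard : A.ncard = B.ncard)
    (h : ∀ b ∈ B, {x | x ∈ B ∧ r x = r b ∧ f x ≤ f b}.ncard ≤
      {x | x ∈ A ∧ r x = r b ∧ f x ≤ f b}.ncard) :
    ∃ e : A ≃ B, ∀ a, r (e a) = r a ∧ f a ≤ f (e a) := by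
  classical
  have := Fintype.ofFinite T
  let t : B → Finset T := fun b => {x | x ∈ A ∧ r x = r b ∧ f x ≤ f b}
  have hall : ∀ S : Finset B, S.card ≤ (S.biUnion t).card := by
    intro S
    have hmaps : ∀ x ∈ S.biUnion t, r x ∈ S.image (fun b : B => r b) := by
      intro x hx
      obtain ⟨b, hb, hxb⟩ := Finset.mem_biUnion.1 hx
      exact Finset.mem_image.2 ⟨b, hb, (Finset.mem_filter.1 hxb).2.2.1.symm⟩
    rw [Finset.card_eq_sum_card_fiberwise hmaps,
      Finset.card_eq_sum_card_image (fun b : B => r b) S]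
    refine Finset.sum_le_sum fun i hi => ?_
    obtain ⟨b₀, hb₀, rfl⟩ := Finset.mem_image.1 hi
    obtain ⟨b, hb, hmax⟩ := Finset.exists_max_image {c ∈ S | r (c : B) = r b₀} (fun c : B => f c)
      ⟨b₀, by simpa using hb₀⟩
    obtain ⟨hbS, hbr⟩ := Finset.mem_filter.1 hb
    have hb' := h b b.2
    rw [hbr, Set.ncard_eq_toFinset_card', Set.ncard_eq_toFinset_card'] at hb'
    refine le_trans ?_ (hb'.trans ?_)
    · rw [← Finset.card_map (Function.Embedding.subtype _)]
      refine Finset.card_le_card fun x hx => ?_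
      obtain ⟨c, hc, rfl⟩ := Finset.mem_map.1 hx
      exact Set.mem_toFinset.2 ⟨c.2, (Finset.mem_filter.1 hc).2, hmax c hc⟩
    · refine Finset.card_le_card fun x hx => ?_
      obtain ⟨hxA, hxr, hxf⟩ := Set.mem_toFinset.1 hx
      exact Finset.mem_filter.2 ⟨Finset.mem_biUnion.2 ⟨b, hbS,
        Finset.mem_filter.2 ⟨Finset.mem_univ _, hxA, hxr.trans hbr.symm, hxf⟩⟩, hxr⟩
  obtain ⟨F, hinj, hF⟩ := (Finset.all_card_le_biUnion_card_iff_exists_injective t).1 hall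
  have hF' : ∀ b, F b ∈ A ∧ r (F b) = r b ∧ f (F b) ≤ f b := fun b =>
    (Finset.mem_filter.1 (hF b)).2
  let F' : B → A := fun b => ⟨F b, (hF' b).1⟩
  have hbij : Function.Bijective F' := by
    refine (Nat.bijective_iff_injective_and_card F').2 ⟨fun b c hbc => hinj ?_, ?_⟩
    · exact congrArg Subtype.val hbc
    · rw [Nat.card_coe_set_eq, Nat.card_coe_set_eq, hcard]
  refine ⟨(Equiv.ofBijective F' hbij).symm, fun a => ?_⟩
  have key : F ((Equiv.ofBijective F' hbij).symm a) = a :=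
    congrArg Subtype.val ((Equiv.ofBijective F' hbij).apply_symm_apply a)
  have := hF' ((Equiv.ofBijective F' hbij).symm a)
  rw [key] at this
  exact ⟨this.2.1.symm, this.2.2⟩

theorem ncomp_le (n : ℕ) (s : Set (Sym2 (Fin n))) : ncomp n s ≤ n := by
  simpa [ncomp] using Nat.card_le_card_of_surjective
    (SimpleGraph.fromEdgeSet s).connectedComponentMk Quot.mk_surjective

/-- if `G` is strong in `C_{n,m}` and `G' ∈ C_{n,m}` then there is a
bijection `φ : S(G) → S(G')` preserving the number of edges and not decreasing the
number of connected components. -/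
theorem stmt10 (n m : ℕ) (hn : 0 < n) (hm : 0 < m) (G G' : SimpleGraph (Fin n))
    (hG : IsCnm n m G) (hS : Strong n m G) (hG' : IsCnm n m G') :
    ∃ φ : {s : Set (Sym2 (Fin n)) // s ⊆ G.edgeSet} ≃
          {s : Set (Sym2 (Fin n)) // s ⊆ G'.edgeSet},
      ∀ s, ((φ s).1.ncard = s.1.ncard ∧ ncomp n s.1 ≤ ncomp n (φ s).1) := by
  refine exists_equiv_of_ncard_le {s | s ⊆ G.edgeSet} {s | s ⊆ G'.edgeSet} Set.ncard (ncomp n)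
    ?_ fun b hb => ?_
  · change (𝒫 G.edgeSet).ncard = (𝒫 G'.edgeSet).ncard
    rw [Set.ncard_powerset, Set.ncard_powerset, hG.2, hG'.2]
  · exact hS G' hG' b.ncard (hG'.2 ▸ Set.ncard_le_ncard hb) (ncomp n b) (one_le_ncomp hn b)
      (ncomp_le n b)
end
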